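/- arXiv:2402.15188 — 5 statements merged into one kernel-verified Lean document; each statement's English description precedes it below -/
import Mathlib

section
/- For every finite nonempty set S ⊆ Θ and every θ' ∈ Θ, the performative confidence bounds are valid: max_{θ∈S} ( DPR(θ, θ') − L_z·ε·‖θ−θ'‖^α ) ≤ PR(θ') ≤ min_{θ∈S} ( DPR(θ, θ') + L_z·ε·‖θ−θ'‖^α ). -/
open MeasureTheory

/-- The performative risk `PR(θ) = E_{z ∼ 𝒟(θ)}[f(θ, z)]`. -/
noncomputable def PR {D : ℕ} {Z : Type*} [MeasurableSpace Z]
    (f : EuclideanSpace ℝ (Fin D) → Z → ℝ)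
    (𝒟 : EuclideanSpace ℝ (Fin D) → Measure Z)
    (θ : EuclideanSpace ℝ (Fin D)) : ℝ :=
  ∫ z, f θ z ∂(𝒟 θ)

/-- The decoupled performative risk `DPR(θ, θ') = E_{z ∼ 𝒟(θ)}[f(θ', z)]`. -/
noncomputable def DPR {D : ℕ} {Z : Type*} [MeasurableSpace Z]
    (f : EuclideanSpace ℝ (Fin D) → Z → ℝ)
    (𝒟 : EuclideanSpace ℝ (Fin D) → Measure Z)
    (θ θ' : EuclideanSpace ℝ (Fin D)) : ℝ :=
  ∫ z, f θ' z ∂(𝒟 θ)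

/-- Performative confidence bounds: for every finite nonempty `S ⊆ Θ` and every `θ' ∈ Θ`,
`max_{θ∈S} (DPR(θ, θ') − L_z·ε·‖θ−θ'‖^α) ≤ PR(θ') ≤ min_{θ∈S} (DPR(θ, θ') + L_z·ε·‖θ−θ'‖^α)`. -/
theorem stmt1 {D : ℕ} (hD : 1 ≤ D)
    {Z : Type*} [MeasurableSpace Z] [MetricSpace Z]
    (Θ : Set (EuclideanSpace ℝ (Fin D))) (hΘ : Θ.Nonempty)
    (f : EuclideanSpace ℝ (Fin D) → Z → ℝ)
    (𝒟 : EuclideanSpace ℝ (Fin D) → Measure Z)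
    (hprob : ∀ θ, IsProbabilityMeasure (𝒟 θ))
    (hint : ∀ θ ∈ Θ, ∀ θ' ∈ Θ, Integrable (f θ') (𝒟 θ))
    {ε α Lz : ℝ} (hε : 0 < ε) (hα : 0 < α) (hLz : 0 < Lz)
    (hsens : ∀ θ ∈ Θ, ∀ θ' ∈ Θ, ∀ g : Z → ℝ,
      (∀ z z' : Z, |g z - g z'| ≤ dist z z') →
      Integrable g (𝒟 θ) → Integrable g (𝒟 θ') →
      |(∫ z, g z ∂(𝒟 θ)) - ∫ z, g z ∂(𝒟 θ')| ≤ ε * ‖θ - θ'‖ ^ α)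
    (hlip : ∀ θ ∈ Θ, ∀ z z' : Z, |f θ z - f θ z'| ≤ Lz * dist z z')
    (S : Finset (EuclideanSpace ℝ (Fin D))) (hS : S.Nonempty) (hSΘ : ↑S ⊆ Θ) :
    ∀ θ' ∈ Θ,
      S.sup' hS (fun θ => DPR f 𝒟 θ θ' - Lz * ε * ‖θ - θ'‖ ^ α) ≤ PR f 𝒟 θ' ∧
      PR f 𝒟 θ' ≤ S.inf' hS (fun θ => DPR f 𝒟 θ θ' + Lz * ε * ‖θ - θ'‖ ^ α) := by
  intro θ' hθ'
  have gap : ∀ θ ∈ S, |DPR f 𝒟 θ θ' - PR f 𝒟 θ'| ≤ Lz * ε * ‖θ - θ'‖ ^ α := by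
    intro θ hθ
    have hθΘ : θ ∈ Θ := hSΘ hθ
    have h := hsens θ hθΘ θ' hθ' (fun z => Lz⁻¹ * f θ' z)
      (fun z z' => by
        rw [← mul_sub, abs_mul, abs_of_pos (inv_pos.2 hLz), inv_mul_le_iff₀ hLz]
        exact hlip θ' hθ' z z')
      ((hint θ hθΘ θ' hθ').const_mul _) ((hint θ' hθ' θ' hθ').const_mul _)
    rwa [integral_const_mul, integral_const_mul, ← mul_sub, abs_mul,
      abs_of_pos (inv_pos.2 hLz), inv_mul_le_iff₀ hLz, ← mul_assoc] at h
  refine ⟨Finset.sup'_le hS _ fun θ hθ => ?_, Finset.le_inf' hS _ fun θ hθ => ?_⟩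
  · linarith [(abs_le.1 (gap θ hθ)).2]
  · linarith [(abs_le.1 (gap θ hθ)).1]
end

section
/- If, in addition, there is L_θ > 0 such that for every z ∈ Z the map θ ↦ f(θ,z) is L_θ-Lipschitz on Θ, then the performative risk satisfies |PR(θ) − PR(θ')| ≤ L_θ·‖θ−θ'‖ + L_z·ε·‖θ−θ'‖^α for all θ, θ' ∈ Θ. -/
open MeasureTheory

/-- Changing the parameter of the loss moves the expected loss by at most `Lθ * ‖θ - θ'‖`. -/
theorem abs_DPR_sub_DPR_le_of_loss {D : ℕ} {Z : Type*} [MeasurableSpace Z]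
    {f : EuclideanSpace ℝ (Fin D) → Z → ℝ} {𝒟 : EuclideanSpace ℝ (Fin D) → Measure Z}
    {η θ θ' : EuclideanSpace ℝ (Fin D)} [IsProbabilityMeasure (𝒟 η)] {Lθ : ℝ}
    (hθ : Integrable (f θ) (𝒟 η)) (hθ' : Integrable (f θ') (𝒟 η))
    (hlip : ∀ z, |f θ z - f θ' z| ≤ Lθ * ‖θ - θ'‖) :
    |DPR f 𝒟 η θ - DPR f 𝒟 η θ'| ≤ Lθ * ‖θ - θ'‖ := by
  unfold DPR
  rw [← integral_sub hθ hθ']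
  simpa using
    norm_integral_le_of_norm_le_const (μ := 𝒟 η) (f := fun z => f θ z - f θ' z)
      (.of_forall hlip)

/-- A bound on the integral discrepancy of two measures over 1-Lipschitz functions scales to
`L`-Lipschitz functions. -/
theorem abs_integral_sub_integral_le_of_lipschitz {Z : Type*} [MeasurableSpace Z] [MetricSpace Z]
    {μ ν : Measure Z} {L C : ℝ} (hL : 0 < L) {g : Z → ℝ}
    (hdual : ∀ h : Z → ℝ, (∀ z z' : Z, |h z - h z'| ≤ dist z z') →
      Integrable h μ → Integrable h ν → |(∫ z, h z ∂μ) - ∫ z, h z ∂ν| ≤ C)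
    (hlip : ∀ z z' : Z, |g z - g z'| ≤ L * dist z z')
    (hμ : Integrable g μ) (hν : Integrable g ν) :
    |(∫ z, g z ∂μ) - ∫ z, g z ∂ν| ≤ L * C := by
  have h := hdual (fun z => g z / L)
    (fun z z' => by
      rw [← sub_div, abs_div, abs_of_pos hL, div_le_iff₀' hL]
      exact hlip z z')
    (hμ.div_const L) (hν.div_const L)
  rwa [integral_div, integral_div, ← sub_div, abs_div, abs_of_pos hL, div_le_iff₀' hL] at h

/-- If additionally `θ ↦ f(θ,z)` is `L_θ`-Lipschitz on `Θ` for every `z`, then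
`|PR(θ) − PR(θ')| ≤ L_θ·‖θ−θ'‖ + L_z·ε·‖θ−θ'‖^α` for all `θ, θ' ∈ Θ`. -/
theorem stmt2 {D : ℕ} (hD : 1 ≤ D)
    {Z : Type*} [MeasurableSpace Z] [MetricSpace Z]
    (Θ : Set (EuclideanSpace ℝ (Fin D))) (hΘ : Θ.Nonempty)
    (f : EuclideanSpace ℝ (Fin D) → Z → ℝ)
    (𝒟 : EuclideanSpace ℝ (Fin D) → Measure Z)
    (hprob : ∀ θ, IsProbabilityMeasure (𝒟 θ))
    (hint : ∀ θ ∈ Θ, ∀ θ' ∈ Θ, Integrable (f θ') (𝒟 θ))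
    {ε α Lz : ℝ} (hε : 0 < ε) (hα : 0 < α) (hLz : 0 < Lz)
    (hsens : ∀ θ ∈ Θ, ∀ θ' ∈ Θ, ∀ g : Z → ℝ,
      (∀ z z' : Z, |g z - g z'| ≤ dist z z') →
      Integrable g (𝒟 θ) → Integrable g (𝒟 θ') →
      |(∫ z, g z ∂(𝒟 θ)) - ∫ z, g z ∂(𝒟 θ')| ≤ ε * ‖θ - θ'‖ ^ α)
    (hlip : ∀ θ ∈ Θ, ∀ z z' : Z, |f θ z - f θ z'| ≤ Lz * dist z z')
    {Lθ : ℝ} (hLθ : 0 < Lθ)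
    (hlipθ : ∀ z : Z, ∀ θ ∈ Θ, ∀ θ' ∈ Θ, |f θ z - f θ' z| ≤ Lθ * ‖θ - θ'‖) :
    ∀ θ ∈ Θ, ∀ θ' ∈ Θ,
      |PR f 𝒟 θ - PR f 𝒟 θ'| ≤ Lθ * ‖θ - θ'‖ + Lz * ε * ‖θ - θ'‖ ^ α := by
  intro θ hθ θ' hθ'
  have hloss : |PR f 𝒟 θ - DPR f 𝒟 θ θ'| ≤ Lθ * ‖θ - θ'‖ :=
    abs_DPR_sub_DPR_le_of_loss (hint θ hθ θ hθ) (hint θ hθ θ' hθ')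
      fun z => hlipθ z θ hθ θ' hθ'
  have hdist : |DPR f 𝒟 θ θ' - PR f 𝒟 θ'| ≤ Lz * (ε * ‖θ - θ'‖ ^ α) :=
    abs_integral_sub_integral_le_of_lipschitz hLz (hsens θ hθ θ' hθ') (hlip θ' hθ')
      (hint θ hθ θ' hθ') (hint θ' hθ' θ' hθ')
  rw [mul_assoc]
  exact (abs_sub_le _ (DPR f 𝒟 θ θ') _).trans (add_le_add hloss hdist)
end

section
/- Let h ∈ ℕ and let P ⊆ Θ be a set (a depth-h cell) such that ‖x − y‖ ≤ √D · 2^{−h} for all x, y ∈ P. Then for any θ_rep ∈ P and any θ ∈ P, |DPR(θ_rep, θ) − PR(θ)| ≤ (√D)^α · L_z · ε · 2^{−αh}. -/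
open MeasureTheory

/-- Dual-form sensitivity bound, rescaled from `1`-Lipschitz to `L`-Lipschitz test functions. -/
theorem abs_integral_sub_le_of_lipschitz {Z : Type*} [MeasurableSpace Z] [MetricSpace Z]
    {μ ν : Measure Z} {L c : ℝ} (hL : 0 < L)
    (hμν : ∀ g : Z → ℝ, (∀ z z' : Z, |g z - g z'| ≤ dist z z') →
      Integrable g μ → Integrable g ν → |(∫ z, g z ∂μ) - ∫ z, g z ∂ν| ≤ c)
    {g : Z → ℝ} (hg : ∀ z z' : Z, |g z - g z'| ≤ L * dist z z')
    (hgμ : Integrable g μ) (hgν : Integrable g ν) :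
    |(∫ z, g z ∂μ) - ∫ z, g z ∂ν| ≤ L * c := by
  have key := hμν (fun z => L⁻¹ * g z) (fun z z' => by
    rw [← mul_sub, abs_mul, abs_of_pos (inv_pos.2 hL), inv_mul_le_iff₀ hL]
    exact hg z z') (hgμ.const_mul _) (hgν.const_mul _)
  rwa [integral_const_mul, integral_const_mul, ← mul_sub, abs_mul,
    abs_of_pos (inv_pos.2 hL), inv_mul_le_iff₀ hL] at key

/-- If `P ⊆ Θ` is a depth-`h` cell of diameter at most `√D·2^{−h}`, then for any
`θ_rep, θ ∈ P`, `|DPR(θ_rep, θ) − PR(θ)| ≤ (√D)^α · L_z · ε · 2^{−αh}`. -/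
theorem stmt3 {D : ℕ} (hD : 1 ≤ D)
    {Z : Type*} [MeasurableSpace Z] [MetricSpace Z]
    (Θ : Set (EuclideanSpace ℝ (Fin D))) (hΘ : Θ.Nonempty)
    (f : EuclideanSpace ℝ (Fin D) → Z → ℝ)
    (𝒟 : EuclideanSpace ℝ (Fin D) → Measure Z)
    (hprob : ∀ θ, IsProbabilityMeasure (𝒟 θ))
    (hint : ∀ θ ∈ Θ, ∀ θ' ∈ Θ, Integrable (f θ') (𝒟 θ))
    {ε α Lz : ℝ} (hε : 0 < ε) (hα : 0 < α) (hLz : 0 < Lz)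
    (hsens : ∀ θ ∈ Θ, ∀ θ' ∈ Θ, ∀ g : Z → ℝ,
      (∀ z z' : Z, |g z - g z'| ≤ dist z z') →
      Integrable g (𝒟 θ) → Integrable g (𝒟 θ') →
      |(∫ z, g z ∂(𝒟 θ)) - ∫ z, g z ∂(𝒟 θ')| ≤ ε * ‖θ - θ'‖ ^ α)
    (hlip : ∀ θ ∈ Θ, ∀ z z' : Z, |f θ z - f θ z'| ≤ Lz * dist z z')
    (h : ℕ) (P : Set (EuclideanSpace ℝ (Fin D))) (hPΘ : P ⊆ Θ)
    (hdiam : ∀ x ∈ P, ∀ y ∈ P, ‖x - y‖ ≤ Real.sqrt D * (2 : ℝ) ^ (-(h : ℝ))) :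
    ∀ θrep ∈ P, ∀ θ ∈ P,
      |DPR f 𝒟 θrep θ - PR f 𝒟 θ| ≤
        Real.sqrt D ^ α * Lz * ε * (2 : ℝ) ^ (-(α * h)) := by
  intro θrep hrep θ hθ
  have hpow : ‖θrep - θ‖ ^ α ≤ Real.sqrt D ^ α * (2 : ℝ) ^ (-(α * h)) := by
    calc ‖θrep - θ‖ ^ α ≤ (Real.sqrt D * (2 : ℝ) ^ (-(h : ℝ))) ^ α :=
          Real.rpow_le_rpow (norm_nonneg _) (hdiam _ hrep _ hθ) hα.le
      _ = Real.sqrt D ^ α * (2 : ℝ) ^ (-(α * h)) := by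
          rw [Real.mul_rpow (Real.sqrt_nonneg _) (by positivity), ← Real.rpow_mul zero_le_two,
            neg_mul, mul_comm (h : ℝ)]
  calc |DPR f 𝒟 θrep θ - PR f 𝒟 θ| ≤ Lz * (ε * ‖θrep - θ‖ ^ α) :=
        abs_integral_sub_le_of_lipschitz hLz (hsens _ (hPΘ hrep) _ (hPΘ hθ)) (hlip _ (hPΘ hθ))
          (hint _ (hPΘ hrep) _ (hPΘ hθ)) (hint _ (hPΘ hθ) _ (hPΘ hθ))
    _ ≤ Lz * (ε * (Real.sqrt D ^ α * (2 : ℝ) ^ (-(α * h)))) := by gcongr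
    _ = Real.sqrt D ^ α * Lz * ε * (2 : ℝ) ^ (-(α * h)) := by ring
end

section
/- For every integer H ≥ 1, with P = ⌊log₂ H⌋, the total number of cell openings in the exploration phase satisfies ∑_{h=1}^{H} ∑_{p=0}^{P} ⌊H/(h·2^p)⌋ · 2^p ≤ H · (P+1)². -/
theorem sum_div_Ico_two_pow_le (n k : ℕ) : ∑ h ∈ Finset.Ico 1 (2 ^ k), n / h ≤ n * k := by
  induction k with
  | zero => simp
  | succ k ih =>
    have hblock : ∑ h ∈ Finset.Ico (2 ^ k) (2 ^ (k + 1)), n / h ≤ n := by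
      calc ∑ h ∈ Finset.Ico (2 ^ k) (2 ^ (k + 1)), n / h
          ≤ ∑ _h ∈ Finset.Ico (2 ^ k) (2 ^ (k + 1)), n / 2 ^ k :=
            Finset.sum_le_sum fun h hh =>
              Nat.div_le_div_left (Finset.mem_Ico.1 hh).1 (by positivity)
        _ = 2 ^ k * (n / 2 ^ k) := by
            rw [Finset.sum_const, Nat.card_Ico, smul_eq_mul, pow_succ, mul_two,
              Nat.add_sub_cancel]
        _ ≤ n := Nat.mul_div_le n _
    rw [← Finset.sum_Ico_consecutive _ Nat.one_le_two_pow
      (Nat.pow_le_pow_right two_pos k.le_succ), mul_add_one]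
    exact add_le_add ih hblock

theorem sum_div_Icc_le (n : ℕ) : ∑ h ∈ Finset.Icc 1 n, n / h ≤ n * (Nat.log 2 n + 1) := by
  refine le_trans (Finset.sum_le_sum_of_subset fun h hh => ?_)
    (sum_div_Ico_two_pow_le n (Nat.log 2 n + 1))
  rw [Finset.mem_Icc] at hh
  exact Finset.mem_Ico.2 ⟨hh.1, hh.2.trans_lt (Nat.lt_pow_succ_log_self one_lt_two n)⟩

/-- For every integer `H ≥ 1`, with `P = ⌊log₂ H⌋`, the total number of cell openings in the
exploration phase satisfies `∑_{h=1}^{H} ∑_{p=0}^{P} ⌊H/(h·2^p)⌋ · 2^p ≤ H · (P+1)²`. -/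
theorem stmt8 (H : ℕ) (hH : 1 ≤ H) (P : ℕ) (hP : P = Nat.log 2 H) :
    ∑ h ∈ Finset.Icc 1 H, ∑ p ∈ Finset.range (P + 1), H / (h * 2 ^ p) * 2 ^ p
      ≤ H * (P + 1) ^ 2 := by
  subst hP
  calc ∑ h ∈ Finset.Icc 1 H, ∑ p ∈ Finset.range (Nat.log 2 H + 1), H / (h * 2 ^ p) * 2 ^ p
      ≤ ∑ h ∈ Finset.Icc 1 H, ∑ _p ∈ Finset.range (Nat.log 2 H + 1), H / h := by
        refine Finset.sum_le_sum fun h _ => Finset.sum_le_sum fun p _ => ?_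
        rw [← Nat.div_div_eq_div_mul]
        exact Nat.div_mul_le_self _ _
    _ = (∑ h ∈ Finset.Icc 1 H, H / h) * (Nat.log 2 H + 1) := by
        simp [Finset.sum_mul, mul_comm]
    _ ≤ H * (Nat.log 2 H + 1) * (Nat.log 2 H + 1) :=
        Nat.mul_le_mul_right _ (sum_div_Icc_le H)
    _ = H * (Nat.log 2 H + 1) ^ 2 := by ring
end

section
/- Let T ≥ 2 and D ≥ 1 be integers, set H = ⌊T / (2^{D+1}·(log₂ T + 1)²)⌋ (the maximum depth h_max of the SOOP algorithm) and P = ⌊log₂ H⌋ (the value p_max), and assume H ≥ 1. Then: (i) H ≤ T/2^{D+3}; (ii) the total number of solution deployments before the cross-validation phase satisfies H + 2^D·H + 2^D·∑_{h=1}^{H} ∑_{p=0}^{P} ⌊H/(h·2^p)⌋·2^p ≤ 3T/4; and (iii) the number of deployments in the cross-validation phase satisfies H·(P+1) ≤ T/4. -/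
/-- A double sum of the rounded quotients `n / (h * 2 ^ p)`, weighted by `2 ^ p`, is at most
`n * (k * Hₙ)`, where `Hₙ` is the harmonic number. -/
theorem sum_div_mul_two_pow_le (n k : ℕ) :
    ((∑ h ∈ Finset.Icc 1 n, ∑ p ∈ Finset.range k, n / (h * 2 ^ p) * 2 ^ p : ℕ) : ℝ)
      ≤ n * (k * (harmonic n : ℝ)) := by
  rw [harmonic_eq_sum_Icc]
  push_cast
  rw [Finset.mul_sum, Finset.mul_sum]
  refine Finset.sum_le_sum fun h hh => ?_
  have hpos : (0 : ℝ) < h := by exact_mod_cast (Finset.mem_Icc.mp hh).1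
  calc ∑ p ∈ Finset.range k, ((n / (h * 2 ^ p) : ℕ) : ℝ) * 2 ^ p
      ≤ ∑ p ∈ Finset.range k, (n : ℝ) * (h : ℝ)⁻¹ := by
        refine Finset.sum_le_sum fun p _ => ?_
        have hdiv : ((n / (h * 2 ^ p) : ℕ) : ℝ) ≤ n / (h * 2 ^ p) := by
          simpa using (Nat.cast_div_le (α := ℝ) (m := n) (n := h * 2 ^ p))
        calc ((n / (h * 2 ^ p) : ℕ) : ℝ) * 2 ^ p ≤ n / (h * 2 ^ p) * 2 ^ p := by gcongr
          _ = n * (h : ℝ)⁻¹ := by field_simp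
    _ = n * (k * (h : ℝ)⁻¹) := by
        rw [Finset.sum_const, Finset.card_range, nsmul_eq_mul]
        ring


/-- Deployment counts for SOOP: with `H = ⌊T / (2^{D+1}·(log₂ T + 1)²)⌋` and `P = ⌊log₂ H⌋`,
(i) `H ≤ T/2^{D+3}`; (ii) the deployments before the cross-validation phase number at most
`3T/4`; (iii) the cross-validation phase uses at most `T/4` deployments. -/
theorem stmt9 (T D : ℕ) (hT : 2 ≤ T) (hD : 1 ≤ D)
    (H P : ℕ)
    (hH : H = ⌊(T : ℝ) / (2 ^ (D + 1) * (Real.logb 2 T + 1) ^ 2)⌋₊)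
    (hP : P = Nat.log 2 H)
    (hH1 : 1 ≤ H) :
    (H : ℝ) ≤ (T : ℝ) / 2 ^ (D + 3) ∧
    (H : ℝ) + 2 ^ D * (H : ℝ)
        + 2 ^ D * ((∑ h ∈ Finset.Icc 1 H, ∑ p ∈ Finset.range (P + 1),
            H / (h * 2 ^ p) * 2 ^ p : ℕ) : ℝ)
      ≤ 3 * (T : ℝ) / 4 ∧
    (H : ℝ) * (P + 1) ≤ (T : ℝ) / 4 := by
  have hT' : (2 : ℝ) ≤ T := by exact_mod_cast hT
  have hlog : 1 ≤ Real.logb 2 T := by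
    rw [Real.le_logb_iff_rpow_le one_lt_two (by linarith)]
    simpa using hT'
  set x := Real.logb 2 T + 1 with hx
  have hx2 : 2 ≤ x := by linarith
  have hA : (2 : ℝ) ≤ 2 ^ D := le_self_pow₀ one_le_two (by omega)
  have hden : (4 : ℝ) ≤ 2 ^ (D + 1) * x ^ 2 := by
    rw [pow_succ]
    nlinarith
  have hbound : (H : ℝ) * (2 ^ (D + 1) * x ^ 2) ≤ T := by
    rw [← le_div_iff₀ (by linarith), hH]
    exact Nat.floor_le (by positivity)
  have hHpos : (1 : ℝ) ≤ H := by exact_mod_cast hH1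
  have hHT : (H : ℝ) ≤ T := by nlinarith
  have hlogb : Real.logb 2 H ≤ Real.logb 2 T :=
    Real.logb_le_logb_of_le one_lt_two (by linarith) hHT
  have hPx : (P : ℝ) + 1 ≤ x := by
    have : (P : ℝ) ≤ Real.logb 2 H := by
      rw [hP]
      exact_mod_cast Real.natLog_le_logb H 2
    linarith
  have hharm : (harmonic H : ℝ) ≤ x := by
    have hln : Real.log H ≤ Real.logb 2 H := by
      rw [Real.logb, le_div_iff₀ (Real.log_pos one_lt_two)]
      have := Real.log_nonneg hHpos
      nlinarith [Real.log_two_lt_d9]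
    linarith [harmonic_le_one_add_log H]
  have hsum := sum_div_mul_two_pow_le H (P + 1)
  have hprod : ((P + 1 : ℕ) : ℝ) * (harmonic H : ℝ) ≤ x ^ 2 := by
    push_cast
    calc ((P : ℝ) + 1) * (harmonic H : ℝ) ≤ ((P : ℝ) + 1) * x := by gcongr
      _ ≤ x * x := by gcongr
      _ = x ^ 2 := by ring
  have hsum' := hsum.trans (mul_le_mul_of_nonneg_left hprod (by linarith : (0 : ℝ) ≤ H))
  rw [pow_succ] at hbound
  have hsq : (4 : ℝ) ≤ x ^ 2 := by nlinarith
  have hHA : 8 * ((H : ℝ) * 2 ^ D) ≤ T := by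
    have : (H : ℝ) * 2 ^ D * 4 ≤ H * 2 ^ D * x ^ 2 := by gcongr
    linarith
  refine ⟨?_, ?_, ?_⟩
  · rw [le_div_iff₀ (by positivity), pow_add]
    linarith
  · have h₁ := mul_le_mul_of_nonneg_left hsum' (by positivity : (0 : ℝ) ≤ 2 ^ D)
    have h₂ : (H : ℝ) * 2 ≤ H * 2 ^ D := by gcongr
    linarith
  · have h₁ : (H : ℝ) * (P + 1) ≤ H * x := by gcongr
    have h₂ : (H : ℝ) * x * 2 ≤ H * x * x := by gcongr
    have h₃ : (H : ℝ) * x ^ 2 * 2 ≤ H * x ^ 2 * 2 ^ D := by gcongr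
    linarith
end
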